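/- Prime-factor permutation-avoiding convolution: let n₁, n₂ ≥ 1, n = n₁·n₂, and fix a bijection e from {0,…,n−1} to pairs (j₂,j₁) with j₂ < n₂, j₁ < n₁; for an n₂×n₂ matrix M and an n₁×n₁ matrix N write M ⊠ N for the n×n matrix with (M⊠N)_{jk} = M_{(e j)₁,(e k)₁} · N_{(e j)₂,(e k)₂}. Suppose Γ and Υ are n×n permutation matrices with F_n = Γ · (F_{n₂} ⊠ F_{n₁}) · Υᵀ, and suppose for q = 1, 2 that F_{n_q} = A_q · P_qᵀ with A_q an n_q×n_q complex matrix and P_q a permutation matrix. Then for all g, x ∈ ℂⁿ: conj(F_n) · (g ∘ (F_n · x)) = Γ · (conj(A₂) ⊠ conj(A₁)) · (ĝ ∘ ((A₂ᵀ ⊠ A₁ᵀ) · (Γᵀ · x))), where ĝ := (P₂ᵀ ⊠ P₁ᵀ) · Υᵀ · g. Dividing by n identifies the left-hand side with the convolution F_n⁻¹ · diag(g) · F_n · x. -/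

import Mathlib

open Matrix Complex

/-- The primitive root `ω_n = exp(−2πi/n)`. -/
noncomputable def ω (n : ℕ) : ℂ := Complex.exp (-(2 * Real.pi * Complex.I) / n)

/-- The `n × n` DFT matrix with 0-based entries `(F_n)_{jk} = ω_n^{j·k}`. -/
noncomputable def dftMatrix (n : ℕ) : Matrix (Fin n) (Fin n) ℂ :=
  fun j k => ω n ^ (j.val * k.val)

/-- The permutation matrix of `σ`, with entries `P_{jk} = 1` if `j = σ k` and `0` otherwise. -/
def permMat {n : ℕ} (σ : Equiv.Perm (Fin n)) : Matrix (Fin n) (Fin n) ℂ :=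
  fun j k => if j = σ k then 1 else 0

/-- `M ⊠ N`: the `n × n` matrix with `(M ⊠ N)_{jk} = M_{(e j)₁,(e k)₁} · N_{(e j)₂,(e k)₂}`,
for a fixed bijection `e` between `{0,…,n−1}` and pairs `(j₂,j₁)`, `j₂ < n₂`, `j₁ < n₁`. -/
noncomputable def kronE {n n₁ n₂ : ℕ} (e : Fin n ≃ Fin n₂ × Fin n₁)
    (M : Matrix (Fin n₂) (Fin n₂) ℂ) (N : Matrix (Fin n₁) (Fin n₁) ℂ) :
    Matrix (Fin n) (Fin n) ℂ :=
  fun j k => M (e j).1 (e k).1 * N (e j).2 (e k).2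

theorem permMat_mulVec {n : ℕ} (σ : Equiv.Perm (Fin n)) (v : Fin n → ℂ) :
    permMat σ *ᵥ v = v ∘ σ.symm := by
  ext i
  simp [permMat, Matrix.mulVec, dotProduct, ← Equiv.symm_apply_eq]

theorem permMat_transpose_mulVec {n : ℕ} (σ : Equiv.Perm (Fin n)) (v : Fin n → ℂ) :
    (permMat σ)ᵀ *ᵥ v = v ∘ σ := by
  ext i
  simp [permMat, Matrix.mulVec, dotProduct]

theorem permMat_mul {n : ℕ} (σ τ : Equiv.Perm (Fin n)) :
    permMat σ * permMat τ = permMat (σ * τ) := by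
  ext i k
  simp only [permMat, Matrix.mul_apply, Equiv.Perm.mul_apply]
  simp
  congr

theorem permMat_map_conj {n : ℕ} (σ : Equiv.Perm (Fin n)) :
    (permMat σ).map (starRingEnd ℂ) = permMat σ := by
  ext i k
  simp [permMat, apply_ite (starRingEnd ℂ)]

section kronE

variable {n n₁ n₂ : ℕ} (e : Fin n ≃ Fin n₂ × Fin n₁)

theorem kronE_mul (M M' : Matrix (Fin n₂) (Fin n₂) ℂ) (N N' : Matrix (Fin n₁) (Fin n₁) ℂ) :
    kronE e (M * M') (N * N') = kronE e M N * kronE e M' N' := by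
  ext i k
  simp only [kronE, Matrix.mul_apply]
  rw [Finset.sum_mul_sum, ← Fintype.sum_prod_type', ← e.sum_comp]
  exact Finset.sum_congr rfl fun _ _ => by ring

theorem kronE_transpose (M : Matrix (Fin n₂) (Fin n₂) ℂ) (N : Matrix (Fin n₁) (Fin n₁) ℂ) :
    (kronE e M N)ᵀ = kronE e Mᵀ Nᵀ := rfl

theorem kronE_map_conj (M : Matrix (Fin n₂) (Fin n₂) ℂ) (N : Matrix (Fin n₁) (Fin n₁) ℂ) :
    (kronE e M N).map (starRingEnd ℂ)
      = kronE e (M.map (starRingEnd ℂ)) (N.map (starRingEnd ℂ)) := by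
  ext i k
  simp [kronE]

theorem kronE_permMat (σ : Equiv.Perm (Fin n₂)) (τ : Equiv.Perm (Fin n₁)) :
    kronE e (permMat σ) (permMat τ)
      = permMat ((e.trans (Equiv.prodCongr σ τ)).trans e.symm) := by
  ext i k
  simp only [kronE, permMat, Equiv.trans_apply, Equiv.eq_symm_apply, Equiv.prodCongr_apply,
    Prod.ext_iff, Prod.map_fst, Prod.map_snd, mul_ite, mul_one, mul_zero]
  split_ifs <;> simp_all

end kronE

theorem dftMatrix_transpose (n : ℕ) : (dftMatrix n)ᵀ = dftMatrix n := by
  ext i k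
  simp [dftMatrix, mul_comm]

theorem ω_isPrimitiveRoot {n : ℕ} (hn : n ≠ 0) : IsPrimitiveRoot (ω n) n := by
  have h : ω n = (Complex.exp (2 * Real.pi * Complex.I / n))⁻¹ := by
    rw [ω, ← Complex.exp_neg, neg_div]
  rw [h]
  exact (Complex.isPrimitiveRoot_exp n hn).inv

theorem conj_ω (n : ℕ) : starRingEnd ℂ (ω n) = (ω n)⁻¹ := by
  rw [ω, ← Complex.exp_conj, ← Complex.exp_neg]
  simp [neg_div, map_ofNat]

theorem dftMatrix_conj_mul_self {n : ℕ} (hn : n ≠ 0) :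
    (dftMatrix n).map (starRingEnd ℂ) * dftMatrix n = (n : ℂ) • 1 := by
  have hω := ω_isPrimitiveRoot hn
  have h0 : ω n ≠ 0 := hω.ne_zero hn
  ext i k
  have hterm : ∀ m : Fin n, starRingEnd ℂ (dftMatrix n i m) * dftMatrix n m k
      = ((ω n ^ i.val)⁻¹ * ω n ^ k.val) ^ m.val := fun m => by
    rw [dftMatrix, dftMatrix, map_pow, conj_ω, mul_pow, inv_pow, inv_pow, ← pow_mul, ← pow_mul,
      mul_comm k.val]
  simp only [Matrix.mul_apply, Matrix.map_apply, hterm, Matrix.smul_apply, smul_eq_mul]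
  rw [Fin.sum_univ_eq_sum_range fun m => ((ω n ^ i.val)⁻¹ * ω n ^ k.val) ^ m]
  rcases eq_or_ne i k with rfl | hik
  · simp [h0]
  · have hr : (ω n ^ i.val)⁻¹ * ω n ^ k.val ≠ 1 := fun h => hik <| Fin.ext <|
      hω.pow_inj i.isLt k.isLt (inv_mul_eq_one₀ (pow_ne_zero _ h0) |>.mp h)
    have hrn : ((ω n ^ i.val)⁻¹ * ω n ^ k.val) ^ n = 1 := by
      rw [mul_pow, inv_pow, pow_right_comm, pow_right_comm _ k.val, hω.pow_eq_one]
      simp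
    rw [geom_sum_eq hr, hrn]
    simp [hik]

theorem dftMatrix_inv {n : ℕ} (hn : n ≠ 0) :
    (dftMatrix n)⁻¹ = ((1 : ℂ) / n) • (dftMatrix n).map (starRingEnd ℂ) := by
  apply Matrix.inv_eq_left_inv
  rw [Matrix.smul_mul, dftMatrix_conj_mul_self hn, smul_smul,
    one_div_mul_cancel (Nat.cast_ne_zero.mpr hn), one_smul]

/-- A symmetric `F = B * Pᵀ`, with `P` a permutation matrix, satisfies
`conj F * (g ∘ (F * x)) = conj B * ((Pᵀ * g) ∘ (Bᵀ * x))`. -/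
theorem conj_mulVec_mul_mulVec_of_eq_mul_permMat_transpose {n : ℕ}
    {F B : Matrix (Fin n) (Fin n) ℂ} {σ : Equiv.Perm (Fin n)} (hF : F = B * (permMat σ)ᵀ)
    (hsymm : Fᵀ = F) (g x : Fin n → ℂ) :
    F.map (starRingEnd ℂ) *ᵥ (g * F *ᵥ x)
      = B.map (starRingEnd ℂ) *ᵥ ((permMat σ)ᵀ *ᵥ g * Bᵀ *ᵥ x) := by
  have hx : F *ᵥ x = permMat σ *ᵥ (Bᵀ *ᵥ x) := by
    rw [← hsymm, hF, Matrix.transpose_mul, Matrix.transpose_transpose, Matrix.mulVec_mulVec]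
  have hconj : F.map (starRingEnd ℂ) = B.map (starRingEnd ℂ) * (permMat σ)ᵀ := by
    rw [hF, Matrix.map_mul, Matrix.transpose_map, permMat_map_conj]
  rw [hx, hconj, ← Matrix.mulVec_mulVec, permMat_transpose_mulVec, permMat_transpose_mulVec,
    permMat_mulVec]
  congr 1
  ext i
  simp

/-- Prime-factor permutation-avoiding convolution: if `F_n = Γ · (F_{n₂} ⊠ F_{n₁}) · Υᵀ`
and `F_{n_q} = A_q · P_qᵀ`, then for all `g, x`:
`conj(F_n) · (g ∘ (F_n·x)) = Γ · (conj A₂ ⊠ conj A₁) · (ĝ ∘ ((A₂ᵀ ⊠ A₁ᵀ)·(Γᵀ·x)))` with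
`ĝ = (P₂ᵀ ⊠ P₁ᵀ)·Υᵀ·g`; dividing by `n` identifies the left-hand side with the convolution
`F_n⁻¹ · diag(g) · F_n · x`. -/
theorem stmt13 (n₁ n₂ : ℕ) (h₁ : 1 ≤ n₁) (h₂ : 1 ≤ n₂)
    (e : Fin (n₁ * n₂) ≃ Fin n₂ × Fin n₁)
    (γ υ : Equiv.Perm (Fin (n₁ * n₂)))
    (A₁ P₁ : Matrix (Fin n₁) (Fin n₁) ℂ) (σ₁ : Equiv.Perm (Fin n₁))
    (hP₁ : ∀ j k, P₁ j k = if j = σ₁ k then 1 else 0)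
    (A₂ P₂ : Matrix (Fin n₂) (Fin n₂) ℂ) (σ₂ : Equiv.Perm (Fin n₂))
    (hP₂ : ∀ j k, P₂ j k = if j = σ₂ k then 1 else 0)
    (hF : dftMatrix (n₁ * n₂)
        = permMat γ * kronE e (dftMatrix n₂) (dftMatrix n₁) * (permMat υ)ᵀ)
    (hF₁ : dftMatrix n₁ = A₁ * P₁ᵀ)
    (hF₂ : dftMatrix n₂ = A₂ * P₂ᵀ)
    (g x ghat : Fin (n₁ * n₂) → ℂ)
    (hghat : ghat = (kronE e P₂ᵀ P₁ᵀ).mulVec ((permMat υ)ᵀ.mulVec g)) :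
    ((dftMatrix (n₁ * n₂)).map (starRingEnd ℂ)).mulVec
        (fun i => g i * (dftMatrix (n₁ * n₂)).mulVec x i)
      = (permMat γ * kronE e (A₂.map (starRingEnd ℂ)) (A₁.map (starRingEnd ℂ))).mulVec
          (fun i => ghat i * (kronE e A₂ᵀ A₁ᵀ).mulVec ((permMat γ)ᵀ.mulVec x) i) ∧
    ((dftMatrix (n₁ * n₂))⁻¹ * Matrix.diagonal g * dftMatrix (n₁ * n₂)).mulVec x
      = ((1 : ℂ) / ((n₁ : ℂ) * (n₂ : ℂ))) •
          (permMat γ * kronE e (A₂.map (starRingEnd ℂ)) (A₁.map (starRingEnd ℂ))).mulVec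
            (fun i => ghat i * (kronE e A₂ᵀ A₁ᵀ).mulVec ((permMat γ)ᵀ.mulVec x) i) := by
  obtain rfl : P₁ = permMat σ₁ := by ext; simp [hP₁, permMat]
  obtain rfl : P₂ = permMat σ₂ := by ext; simp [hP₂, permMat]
  set ρ := (e.trans (Equiv.prodCongr σ₂ σ₁)).trans e.symm
  have hρ : kronE e (permMat σ₂)ᵀ (permMat σ₁)ᵀ = (permMat ρ)ᵀ := by
    rw [← kronE_transpose, kronE_permMat]
  have hW : (permMat ρ)ᵀ * (permMat υ)ᵀ = (permMat (υ * ρ))ᵀ := by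
    rw [← Matrix.transpose_mul, permMat_mul]
  have hFW : dftMatrix (n₁ * n₂) = permMat γ * kronE e A₂ A₁ * (permMat (υ * ρ))ᵀ := by
    rw [hF, hF₁, hF₂, kronE_mul, hρ, ← hW]
    simp only [Matrix.mul_assoc]
  have hconv := conj_mulVec_mul_mulVec_of_eq_mul_permMat_transpose hFW (dftMatrix_transpose _) g x
  rw [Matrix.map_mul, permMat_map_conj, kronE_map_conj, ← hW, ← hρ, ← Matrix.mulVec_mulVec g,
    ← hghat, Matrix.transpose_mul, kronE_transpose, ← Matrix.mulVec_mulVec x] at hconv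
  refine ⟨hconv, ?_⟩
  have hdiag : Matrix.diagonal g *ᵥ (dftMatrix (n₁ * n₂) *ᵥ x)
      = g * dftMatrix (n₁ * n₂) *ᵥ x := by
    ext i
    simp [Matrix.mulVec_diagonal]
  rw [← Matrix.mulVec_mulVec, ← Matrix.mulVec_mulVec, hdiag,
    dftMatrix_inv (Nat.mul_ne_zero (by omega) (by omega)), Matrix.smul_mulVec, hconv, Nat.cast_mul]
  rfl
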